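/- Let Δ > 0 and Δ̄ > 0 be real numbers. Then the minimum of Σ_{t=1}^{ℓ−1} Σ_{c ∈ Ac(t) ∩ Ac(t+1)} w_{t,c}² over all points of the wiggle-height polytope is attained and equals the minimum of QWH(y) over all (Δ,Δ̄)-nice coordinations y, which is also attained. -/

import Mathlib

open scoped Classical

noncomputable section

/-- An ordered storyline instance over a finite character type `C`. -/
structure Storyline (C : Type) [Fintype C] [DecidableEq C] where
  /-- the number `ℓ` of time steps; time steps are `1, …, len` -/
  len : ℕ
  len_pos : 0 < len
  /-- the set `A(c)` of time steps on which character `c` is active -/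
  active : C → Finset ℕ
  active_nonempty : ∀ c, (active c).Nonempty
  active_subset : ∀ c, active c ⊆ Finset.Icc 1 len
  /-- active time steps of a character are consecutive -/
  active_consec : ∀ c s t u, s ∈ active c → u ∈ active c → s ≤ t → t ≤ u → t ∈ active c
  /-- meetings, each given by its time step together with its set of characters -/
  meetings : Finset (ℕ × Finset C)
  meet_time : ∀ m ∈ meetings, m.1 ∈ Finset.Icc 1 len
  meet_active : ∀ m ∈ meetings, ∀ c ∈ m.2, m.1 ∈ active c
  /-- `pos t c` is the position of character `c` in the linear order `π_t` -/
  pos : ℕ → C → ℕ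
  pos_injOn : ∀ t : ℕ, Set.InjOn (pos t) {c | t ∈ active c}
  pos_lt : ∀ t c, t ∈ active c → pos t c < (Finset.univ.filter fun c' => t ∈ active c').card
  /-- the characters of each meeting appear consecutively in the order of its time step -/
  meet_consec : ∀ m ∈ meetings, ∀ c c'', c ∈ m.2 → c'' ∈ m.2 →
    ∀ c', m.1 ∈ active c' → pos m.1 c ≤ pos m.1 c' → pos m.1 c' ≤ pos m.1 c'' → c' ∈ m.2

namespace Storyline

variable {C : Type} [Fintype C] [DecidableEq C] (S : Storyline C)

/-- The set `T = {1, …, ℓ}` of time steps. -/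
def T : Finset ℕ := Finset.Icc 1 S.len

/-- `Ac(t)`, the set of characters active at time step `t`. -/
def Ac (t : ℕ) : Finset C := Finset.univ.filter fun c => t ∈ S.active c

/-- `c` and `c'` belong to a common meeting at time step `t`. -/
def SameMeeting (t : ℕ) (c c' : C) : Prop :=
  ∃ m ∈ S.meetings, m.1 = t ∧ c ∈ m.2 ∧ c' ∈ m.2

/-- `c` and `c'` are consecutive in `π_t` with `c ≺_t c'`. -/
def Consecutive (t : ℕ) (c c' : C) : Prop :=
  t ∈ S.active c ∧ t ∈ S.active c' ∧ S.pos t c' = S.pos t c + 1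

/-- A coordination (`y t c` for `t ∈ A(c)`; other values are irrelevant) is valid if it
respects all the orders `π_t`. -/
def Valid (y : ℕ → C → ℝ) : Prop :=
  ∀ t c c', t ∈ S.active c → t ∈ S.active c' → S.pos t c < S.pos t c' → y t c < y t c'

/-- A `(Δ, Δ̄)`-nice coordination. -/
def Nice (Δ Δbar : ℝ) (y : ℕ → C → ℝ) : Prop :=
  S.Valid y ∧
  ∀ t c c', S.Consecutive t c c' →
    (S.SameMeeting t c c' → |y t c' - y t c| = Δ) ∧
    (¬ S.SameMeeting t c c' → Δbar ≤ |y t c' - y t c|)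

/-- A coordination is integral if all its (relevant) values are integers. -/
def Integral (y : ℕ → C → ℝ) : Prop :=
  ∀ t c, t ∈ S.active c → ∃ z : ℤ, y t c = (z : ℝ)

/-- The total wiggle count `WC(y)`. -/
def WC (y : ℕ → C → ℝ) : ℕ :=
  Set.ncard {p : ℕ × C | 1 ≤ p.1 ∧ p.1 + 1 ≤ S.len ∧ p.1 ∈ S.active p.2 ∧
    p.1 + 1 ∈ S.active p.2 ∧ y p.1 p.2 ≠ y (p.1 + 1) p.2}

/-- The total linear wiggle height `LWH(y)`. -/
def LWH (y : ℕ → C → ℝ) : ℝ :=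
  ∑ t ∈ Finset.Icc 1 (S.len - 1), ∑ c ∈ S.Ac t ∩ S.Ac (t + 1), |y t c - y (t + 1) c|

/-- The total quadratic wiggle height `QWH(y)`. -/
def QWH (y : ℕ → C → ℝ) : ℝ :=
  ∑ t ∈ Finset.Icc 1 (S.len - 1), ∑ c ∈ S.Ac t ∩ S.Ac (t + 1), (y t c - y (t + 1) c) ^ 2

/-- Character `c` is wiggle-free in coordination `y`. -/
def WiggleFree (y : ℕ → C → ℝ) (c : C) : Prop :=
  ∀ t, t ∈ S.active c → t + 1 ∈ S.active c → y t c = y (t + 1) c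

/-- Membership in the wiggle-height polytope (variables `y t c` for `t ∈ A(c)` and
`w t c` for `1 ≤ t ≤ ℓ - 1`, `c ∈ Ac(t) ∩ Ac(t+1)`; other values irrelevant). -/
def InPolytope (Δ Δbar : ℝ) (y w : ℕ → C → ℝ) : Prop :=
  (∀ t c c', S.Consecutive t c c' → S.SameMeeting t c c' → y t c' - y t c = Δ) ∧
  (∀ t c c', S.Consecutive t c c' → ¬ S.SameMeeting t c c' → Δbar ≤ y t c' - y t c) ∧
  (∀ t c, 1 ≤ t → t + 1 ≤ S.len → t ∈ S.active c → t + 1 ∈ S.active c →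
    y t c - y (t + 1) c ≤ w t c ∧ y (t + 1) c - y t c ≤ w t c) ∧
  (∀ t c, t ∈ S.active c → 0 ≤ y t c)

/-- `gap_t(c, c') = pos_t(c') - pos_t(c)` (as a real number). -/
def gap (t : ℕ) (c c' : C) : ℝ := (S.pos t c' : ℝ) - (S.pos t c : ℝ)

/-- `Ccons_t(c, c')`: the number of positions `k` with `pos_t(c) ≤ k < pos_t(c')` such that
the characters at positions `k` and `k + 1` of `π_t` belong to a common meeting at `t`. -/
def Ccons (t : ℕ) (c c' : C) : ℕ :=
  Set.ncard {k : ℕ | S.pos t c ≤ k ∧ k < S.pos t c' ∧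
    ∃ d d', t ∈ S.active d ∧ t ∈ S.active d' ∧ S.pos t d = k ∧ S.pos t d' = k + 1 ∧
      S.SameMeeting t d d'}

/-- `miny_t(c, c')`. -/
def miny (Δ Δbar : ℝ) (t : ℕ) (c c' : C) : ℝ :=
  (S.Ccons t c c' : ℝ) * Δ + (S.gap t c c' - (S.Ccons t c c' : ℝ)) * Δbar

/-- `maxy_t(c, c')` (with value `+∞` when `c` and `c'` share no meeting at `t`). -/
def maxy (Δ : ℝ) (t : ℕ) (c c' : C) : EReal :=
  if S.SameMeeting t c c' then ((Δ * S.gap t c c' : ℝ) : EReal) else ⊤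

end Storyline

namespace Storyline

variable {C : Type} [Fintype C] [DecidableEq C] (S : Storyline C)

/-- The QP objective `Σ_t Σ_c w_{t,c}²`. -/
noncomputable def sumWsq (w : ℕ → C → ℝ) : ℝ :=
  ∑ t ∈ Finset.Icc 1 (S.len - 1), ∑ c ∈ S.Ac t ∩ S.Ac (t + 1), (w t c) ^ 2

/-- Finitely many reals can be moved into a bounded interval so that distances up to `K` are
preserved and larger distances remain at least `K`. -/
theorem exists_bounded_compression {ι : Type*} (s : Finset ι) (x : ι → ℝ) {K : ℝ} (hK : 0 ≤ K) :
    ∃ f : ι → ℝ, (∀ i, f i ∈ Set.Icc 0 (s.card * K)) ∧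
      (∀ i ∈ s, ∀ j, 0 ≤ x j - x i → x j - x i ≤ K → f j - f i = x j - x i) ∧
      (∀ i ∈ s, ∀ j, K ≤ x j - x i → K ≤ f j - f i) := by
  set U : Set ℝ := ⋃ i ∈ s, Set.Icc (x i) (x i + K)
  have hU_le : MeasureTheory.volume.real U ≤ s.card * K := by
    refine (MeasureTheory.measureReal_biUnion_finset_le s _).trans ?_
    simp [Real.volume_real_Icc, hK]
  have hU_fin : MeasureTheory.volume U ≠ ⊤ := by
    refine ne_of_lt ((MeasureTheory.measure_biUnion_finset_le s _).trans_lt ?_)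
    simpa using ENNReal.mul_lt_top (ENNReal.natCast_lt_top s.card) ENNReal.ofReal_lt_top
  have hsub_fin : ∀ A : Set ℝ, MeasureTheory.volume (U ∩ A) ≠ ⊤ := fun A =>
    MeasureTheory.measure_ne_top_of_subset Set.inter_subset_left hU_fin
  have hdiff : ∀ a b : ℝ, a ≤ b →
      MeasureTheory.volume.real (U ∩ Set.Iic b) - MeasureTheory.volume.real (U ∩ Set.Iic a) =
        MeasureTheory.volume.real (U ∩ Set.Ioc a b) := by
    intro a b hab
    have hUm : MeasurableSet U := s.measurableSet_biUnion fun _ _ => measurableSet_Icc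
    have hsplit : U ∩ Set.Iic b = (U ∩ Set.Iic a) ∪ (U ∩ Set.Ioc a b) := by
      rw [← Set.inter_union_distrib_left, Set.Iic_union_Ioc_eq_Iic hab]
    rw [hsplit, MeasureTheory.measureReal_union _ (hUm.inter measurableSet_Ioc)
      (hsub_fin _) (hsub_fin _)]
    · ring
    · exact (Set.Iic_disjoint_Ioc le_rfl).mono Set.inter_subset_right Set.inter_subset_right
  have hIoc : ∀ i ∈ s, Set.Ioc (x i) (x i + K) ⊆ U := fun i hi =>
    Set.Ioc_subset_Icc_self.trans
      (Set.subset_biUnion_of_mem (u := fun i => Set.Icc (x i) (x i + K)) hi)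
  refine ⟨fun i => MeasureTheory.volume.real (U ∩ Set.Iic (x i)), fun i => ?_, ?_, ?_⟩
  · exact ⟨MeasureTheory.measureReal_nonneg,
      (MeasureTheory.measureReal_mono Set.inter_subset_left hU_fin).trans hU_le⟩
  · intro i hi j h0 h1
    have hsub : Set.Ioc (x i) (x j) ⊆ U :=
      (Set.Ioc_subset_Ioc_right (by linarith)).trans (hIoc i hi)
    simp only
    rw [hdiff _ _ (by linarith), Set.inter_eq_self_of_subset_right hsub,
      Real.volume_real_Ioc_of_le (by linarith)]
  · intro i hi j h
    have hsub : Set.Ioc (x i) (x i + K) ⊆ U ∩ Set.Ioc (x i) (x j) :=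
      Set.subset_inter (hIoc i hi) (Set.Ioc_subset_Ioc_right (by linarith))
    simp only
    rw [hdiff _ _ (by linarith)]
    have := MeasureTheory.measureReal_mono hsub (hsub_fin _)
    rwa [Real.volume_real_Ioc_of_le (by linarith), add_sub_cancel_left] at this

/-- The spacing constraints between consecutive characters, with signed differences. -/
def Spaced (Δ Δbar : ℝ) (y : ℕ → C → ℝ) : Prop :=
  (∀ t c c', S.Consecutive t c c' → S.SameMeeting t c c' → y t c' - y t c = Δ) ∧
  (∀ t c c', S.Consecutive t c c' → ¬ S.SameMeeting t c c' → Δbar ≤ y t c' - y t c)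

/-- Every position below the number of active characters is occupied. -/
theorem exists_pos_eq {t k : ℕ} (hk : k < (S.Ac t).card) :
    ∃ c, t ∈ S.active c ∧ S.pos t c = k := by
  have himage : (S.Ac t).image (S.pos t) = Finset.range (S.Ac t).card := by
    apply Finset.eq_of_subset_of_card_le
    · intro k hk
      obtain ⟨c, hc, rfl⟩ := Finset.mem_image.1 hk
      exact Finset.mem_range.2 (S.pos_lt t c (by simpa [Ac] using hc))
    · rw [Finset.card_range, Finset.card_image_of_injOn]
      intro a ha b hb hab
      exact S.pos_injOn t (by simpa [Ac] using ha) (by simpa [Ac] using hb) hab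
  have := Finset.mem_range.2 hk
  rw [← himage] at this
  obtain ⟨c, hc, h⟩ := Finset.mem_image.1 this
  exact ⟨c, by simpa [Ac] using hc, h⟩

variable {S} {Δ Δbar : ℝ}

theorem Spaced.valid {y : ℕ → C → ℝ} (hΔ : 0 < Δ) (hΔbar : 0 < Δbar)
    (h : S.Spaced Δ Δbar y) : S.Valid y := by
  have hstep : ∀ t c c', S.Consecutive t c c' → y t c < y t c' := by
    intro t c c' hc
    by_cases hm : S.SameMeeting t c c'
    · linarith [h.1 t c c' hc hm]
    · linarith [h.2 t c c' hc hm]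
  suffices H : ∀ n t c c', t ∈ S.active c → t ∈ S.active c' →
      S.pos t c' = S.pos t c + n + 1 → y t c < y t c' by
    intro t c c' hc hc' hlt
    obtain ⟨n, hn⟩ := Nat.exists_eq_add_of_lt hlt
    exact H n t c c' hc hc' hn
  intro n
  induction n with
  | zero => exact fun t c c' hc hc' hp => hstep t c c' ⟨hc, hc', hp⟩
  | succ n ih =>
    intro t c c' hc hc' hp
    have hlt : S.pos t c' < (S.Ac t).card := S.pos_lt t c' hc'
    obtain ⟨d, hd, hdp⟩ := S.exists_pos_eq (t := t) (k := S.pos t c + n + 1) (by omega)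
    exact (ih t c d hc hd hdp).trans (hstep t d c' ⟨hd, hc', by omega⟩)

theorem nice_iff_spaced {y : ℕ → C → ℝ} (hΔ : 0 < Δ) (hΔbar : 0 < Δbar) :
    S.Nice Δ Δbar y ↔ S.Spaced Δ Δbar y := by
  have habs : S.Valid y → ∀ t c c', S.Consecutive t c c' →
      |y t c' - y t c| = y t c' - y t c := by
    intro hv t c c' hc
    exact abs_of_pos (sub_pos.2 (hv t c c' hc.1 hc.2.1 (by have := hc.2.2; omega)))
  constructor
  · rintro ⟨hv, h⟩
    exact ⟨fun t c c' hc hm => habs hv t c c' hc ▸ (h t c c' hc).1 hm,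
      fun t c c' hc hm => habs hv t c c' hc ▸ (h t c c' hc).2 hm⟩
  · intro h
    have hv := h.valid hΔ hΔbar
    refine ⟨hv, fun t c c' hc => ?_⟩
    rw [habs hv t c c' hc]
    exact ⟨h.1 t c c' hc, h.2 t c c' hc⟩

variable (S Δ Δbar) in
theorem exists_spaced : ∃ y, S.Spaced Δ Δbar y := by
  let g : ℕ → ℕ → ℝ := fun t k =>
    if ∃ d d', S.Consecutive t d d' ∧ S.pos t d = k ∧ S.SameMeeting t d d' then Δ else Δbar
  have hdiff : ∀ t c c', S.Consecutive t c c' →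
      ∑ k ∈ Finset.range (S.pos t c'), g t k - ∑ k ∈ Finset.range (S.pos t c), g t k =
        g t (S.pos t c) := by
    intro t c c' hc
    rw [hc.2.2, Finset.sum_range_succ, add_sub_cancel_left]
  refine ⟨fun t c => ∑ k ∈ Finset.range (S.pos t c), g t k, ?_, ?_⟩
  · intro t c c' hc hm
    simp only
    rw [hdiff t c c' hc]
    exact if_pos ⟨c, c', hc, rfl, hm⟩
  · intro t c c' hc hm
    simp only
    rw [hdiff t c c' hc]
    refine (if_neg ?_).ge
    rintro ⟨d, d', hd, hp, hm'⟩
    obtain rfl : d = c := S.pos_injOn t hd.1 hc.1 hp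
    obtain rfl : d' = c' :=
      S.pos_injOn t hd.2.1 hc.2.1 (by rw [hd.2.2, hc.2.2])
    exact hm hm'

theorem isClosed_spaced : IsClosed {y | S.Spaced Δ Δbar y} := by
  have hcont : ∀ t c c', Continuous fun y : ℕ → C → ℝ => y t c' - y t c := by
    intro t c c'
    fun_prop
  simp only [Spaced, Set.ofPred_and, Set.ofPred_forall]
  refine IsClosed.inter ?_ ?_
  · exact isClosed_iInter fun t => isClosed_iInter fun c => isClosed_iInter fun c' =>
      isClosed_iInter fun _ => isClosed_iInter fun _ =>
        isClosed_eq (hcont t c c') continuous_const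
  · exact isClosed_iInter fun t => isClosed_iInter fun c => isClosed_iInter fun c' =>
      isClosed_iInter fun _ => isClosed_iInter fun _ =>
        isClosed_le continuous_const (hcont t c c')

theorem mem_Ac {t : ℕ} {c : C} : c ∈ S.Ac t ↔ t ∈ S.active c := by
  simp [Ac]

theorem abs_sub_le_sqrt_QWH (y : ℕ → C → ℝ) {t : ℕ} {c : C} (ht : t ∈ Finset.Icc 1 (S.len - 1))
    (hc : c ∈ S.Ac t ∩ S.Ac (t + 1)) : |y t c - y (t + 1) c| ≤ √(S.QWH y) := by
  refine Real.abs_le_sqrt ?_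
  refine (Finset.single_le_sum (f := fun c => (y t c - y (t + 1) c) ^ 2)
    (fun _ _ => sq_nonneg _) hc).trans ?_
  exact Finset.single_le_sum
    (f := fun t => ∑ c ∈ S.Ac t ∩ S.Ac (t + 1), (y t c - y (t + 1) c) ^ 2)
    (fun _ _ => Finset.sum_nonneg fun _ _ => sq_nonneg _) ht

/-- A spaced coordination of bounded quadratic wiggle height can be moved into a box that only
depends on the bound, without changing its quadratic wiggle height. -/
theorem Spaced.exists_bounded {y : ℕ → C → ℝ} {K : ℝ} (hΔ : 0 ≤ Δ) (hΔbar : 0 ≤ Δbar)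
    (h : S.Spaced Δ Δbar y) (hKΔ : Δ ≤ K) (hKΔbar : Δbar ≤ K) (hK : √(S.QWH y) ≤ K) :
    ∃ z, S.Spaced Δ Δbar z ∧ S.QWH z = S.QWH y ∧
      ∀ t c, z t c ∈ Set.Icc 0 ((S.T ×ˢ (Finset.univ : Finset C)).card * K) := by
  obtain ⟨f, hf, hnear, hfar⟩ := exists_bounded_compression
    (S.T ×ˢ (Finset.univ : Finset C)) (fun p => y p.1 p.2) (hΔ.trans hKΔ)
  have hmem : ∀ {t c}, t ∈ S.active c → (t, c) ∈ S.T ×ˢ (Finset.univ : Finset C) :=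
    fun ht => Finset.mem_product.2 ⟨S.active_subset _ ht, Finset.mem_univ _⟩
  refine ⟨fun t c => f (t, c), ⟨?_, ?_⟩, ?_, fun t c => hf (t, c)⟩
  · intro t c c' hc hm
    have heq := h.1 t c c' hc hm
    simpa [heq] using
      hnear (t, c) (hmem hc.1) (t, c') (by simpa [heq] using hΔ) (by simpa [heq] using hKΔ)
  · intro t c c' hc hm
    have hle := h.2 t c c' hc hm
    rcases le_total (y t c' - y t c) K with hs | hs
    · simpa [hnear (t, c) (hmem hc.1) (t, c') (hΔbar.trans hle) hs] using hle
    · exact hKΔbar.trans (hfar (t, c) (hmem hc.1) (t, c') hs)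
  · refine Finset.sum_congr rfl fun t ht => Finset.sum_congr rfl fun c hc => ?_
    have habs := abs_le.1 ((abs_sub_le_sqrt_QWH y ht hc).trans hK)
    have hc1 := hmem (mem_Ac.1 (Finset.mem_inter.1 hc).1)
    have hc2 := hmem (mem_Ac.1 (Finset.mem_inter.1 hc).2)
    rcases le_total (y t c) (y (t + 1) c) with hs | hs
    · have := hnear (t, c) hc1 (t + 1, c) (sub_nonneg.2 hs) (by simp only; linarith)
      rw [← neg_sq, neg_sub, this, ← neg_sq, neg_sub]
    · rw [hnear (t + 1, c) hc2 (t, c) (sub_nonneg.2 hs) habs.2]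

variable (S) in
theorem exists_spaced_min_QWH (hΔ : 0 ≤ Δ) (hΔbar : 0 ≤ Δbar) :
    ∃ y, S.Spaced Δ Δbar y ∧ (∀ t c, 0 ≤ y t c) ∧
      ∀ z, S.Spaced Δ Δbar z → S.QWH y ≤ S.QWH z := by
  obtain ⟨y₀, hy₀⟩ := S.exists_spaced Δ Δbar
  let K := max (√(S.QWH y₀)) (max Δ Δbar)
  let B := (S.T ×ˢ (Finset.univ : Finset C)).card * K
  let box : Set (ℕ → C → ℝ) := Set.univ.pi fun _ => Set.univ.pi fun _ => Set.Icc 0 B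
  have hcompress : ∀ z, S.Spaced Δ Δbar z → S.QWH z ≤ S.QWH y₀ →
      ∃ z' ∈ box ∩ {y | S.Spaced Δ Δbar y}, S.QWH z' = S.QWH z := by
    intro z hz hle
    obtain ⟨z', hz', hq, hb⟩ := hz.exists_bounded (K := K) hΔ hΔbar
      ((le_max_left _ _).trans (le_max_right _ _)) ((le_max_right _ _).trans (le_max_right _ _))
      ((Real.sqrt_le_sqrt hle).trans (le_max_left _ _))
    exact ⟨z', ⟨fun t _ c _ => hb t c, hz'⟩, hq⟩
  have hcompact : IsCompact (box ∩ {y | S.Spaced Δ Δbar y}) :=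
    (isCompact_univ_pi fun _ => isCompact_univ_pi fun _ => isCompact_Icc).inter_right
      isClosed_spaced
  have hcont : Continuous S.QWH := by
    unfold QWH
    fun_prop
  obtain ⟨y₁, hy₁, hq₁⟩ := hcompress y₀ hy₀ le_rfl
  obtain ⟨y, ⟨hbox, hy⟩, hmin⟩ := hcompact.exists_isMinOn ⟨y₁, hy₁⟩ hcont.continuousOn
  refine ⟨y, hy, fun t c => (hbox t trivial c trivial).1, fun z hz => ?_⟩
  rcases le_total (S.QWH z) (S.QWH y₀) with hle | hle
  · obtain ⟨z', hz', hq⟩ := hcompress z hz hle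
    exact hq ▸ hmin hz'
  · exact (hq₁ ▸ hmin hy₁ : S.QWH y ≤ S.QWH y₀).trans hle

theorem InPolytope.QWH_le_sumWsq {y w : ℕ → C → ℝ} (h : S.InPolytope Δ Δbar y w) :
    S.QWH y ≤ S.sumWsq w := by
  refine Finset.sum_le_sum fun t ht => Finset.sum_le_sum fun c hc => ?_
  have ht' := Finset.mem_Icc.1 ht
  have hw := h.2.2.1 t c ht'.1 (by omega) (mem_Ac.1 (Finset.mem_inter.1 hc).1)
    (mem_Ac.1 (Finset.mem_inter.1 hc).2)
  exact sq_le_sq' (by linarith [hw.2]) hw.1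

variable (S)

/-- For reals `Δ > 0`, `Δ̄ > 0`: the minimum of the QP objective over the wiggle-height
polytope is attained and equals the minimum of `QWH` over `(Δ, Δ̄)`-nice coordinations,
which is also attained. -/
theorem qp_min_eq_qwhMin (Δ Δbar : ℝ) (hΔ : 0 < Δ) (hΔbar : 0 < Δbar) :
    ∃ v : ℝ,
      IsLeast {v : ℝ | ∃ y w, S.InPolytope Δ Δbar y w ∧ S.sumWsq w = v} v ∧
      IsLeast {v : ℝ | ∃ y, S.Nice Δ Δbar y ∧ S.QWH y = v} v := by
  obtain ⟨y, hy, hnonneg, hmin⟩ := S.exists_spaced_min_QWH hΔ.le hΔbar.le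
  refine ⟨S.QWH y, ⟨?_, ?_⟩, ⟨y, (nice_iff_spaced hΔ hΔbar).2 hy, rfl⟩, ?_⟩
  · refine ⟨y, fun t c => |y t c - y (t + 1) c|, ⟨hy.1, hy.2, ?_, fun t c _ => hnonneg t c⟩, ?_⟩
    · exact fun t c _ _ _ _ => ⟨le_abs_self _, by simpa using neg_le_abs (y t c - y (t + 1) c)⟩
    · simp [sumWsq, QWH]
  · rintro _ ⟨z, w, hzw, rfl⟩
    exact (hmin z ⟨hzw.1, hzw.2.1⟩).trans hzw.QWH_le_sumWsq
  · rintro _ ⟨z, hz, rfl⟩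
    exact hmin z ((nice_iff_spaced hΔ hΔbar).1 hz)

end Storyline
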